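/- (Uniform boundedness of minimizers under varying data.) Let α > 0 and S ⊆ Ω be measurable, let (y_k) ⊆ Y be a convergent sequence, and for each k let x_k ∈ D(F) be a minimizer of J_{α,S,y_k} over D(F). Then the sequences (‖x_k‖_{L²}) and (‖F(x_k)‖_Y) are bounded; consequently there exist x̄ ∈ D(F) and a subsequence (x_m) of (x_k) with x_m ⇀ x̄ weakly in L²(Ω) and F(x_m) ⇀ F(x̄) weakly in Y. -/

import Mathlib

open MeasureTheory Filter
open scoped RealInnerProductSpace ENNReal Topology

noncomputable section

/-- Weak sequential convergence in a real inner product space. -/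
def WeakConv {H : Type*} [NormedAddCommGroup H] [InnerProductSpace ℝ H]
    (u : ℕ → H) (x : H) : Prop :=
  ∀ z : H, Tendsto (fun k => ⟪u k, z⟫) atTop (𝓝 ⟪x, z⟫)

/-- The squared `L²` mass of (a representative of) `x : L²(Ω)` over the set `T`. -/
def sqInt {n : ℕ} (Ω : Set (Fin n → ℝ)) (T : Set (Fin n → ℝ))
    (x : Lp ℝ 2 (volume.restrict Ω)) : ℝ :=
  ∫ t in T, (x t) ^ 2 ∂(volume.restrict Ω)

/-- The Tikhonov-type functional
`J_{α,S,z}(x) = ‖F(x) − z‖² + α‖x − x*‖_{S⁺}² + ‖x − x*‖_{S⁻}²`. -/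
def J {n : ℕ} (Ω : Set (Fin n → ℝ)) {Y : Type*} [NormedAddCommGroup Y]
    [InnerProductSpace ℝ Y]
    (F : Lp ℝ 2 (volume.restrict Ω) → Y) (xstar : Lp ℝ 2 (volume.restrict Ω))
    (α : ℝ) (S : Set (Fin n → ℝ)) (z : Y) (x : Lp ℝ 2 (volume.restrict Ω)) : ℝ :=
  ‖F x - z‖ ^ 2 + (α * sqInt Ω S (x - xstar) + sqInt Ω (Ω \ S) (x - xstar))

/-- `x` is a minimizer of the functional `Jf` over the set `D`. -/
def IsMinimizer {X' : Type*} (Jf : X' → ℝ) (D : Set X') (x : X') : Prop :=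
  x ∈ D ∧ ∀ x' ∈ D, Jf x ≤ Jf x'


theorem weak_subseq_aux {H : Type*} [NormedAddCommGroup H] [InnerProductSpace ℝ H]
    [CompleteSpace H] (u : ℕ → H) (B : ℝ) (hB : ∀ k, ‖u k‖ ≤ B) :
    ∃ x : H, ∃ φ : ℕ → ℕ, StrictMono φ ∧ WeakConv (u ∘ φ) x := by
  let K : Submodule ℝ H := (Submodule.span ℝ (Set.range u)).topologicalClosure
  have hKc : IsClosed (K : Set H) := Submodule.isClosed_topologicalClosure _
  have : CompleteSpace K := hKc.completeSpace_coe
  have hsep : TopologicalSpace.IsSeparable (K : Set H) := by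
    have h1 := (Set.countable_range u).isSeparable
    have h2 : TopologicalSpace.IsSeparable (Submodule.span ℝ (Set.range u) : Set H) := h1.span
    exact h2.closure
  have : TopologicalSpace.SeparableSpace K := hsep.separableSpace
  have huK : ∀ k, u k ∈ K := fun k =>
    Submodule.le_topologicalClosure _ (Submodule.subset_span (Set.mem_range_self k))
  let v : ℕ → K := fun k => ⟨u k, huK k⟩
  let f : ℕ → WeakDual ℝ K := fun k => StrongDual.toWeakDual (InnerProductSpace.toDual ℝ K (v k))
  have hf : ∀ k, f k ∈ WeakDual.toStrongDual ⁻¹' Metric.closedBall (0 : StrongDual ℝ K) B := by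
    intro k
    change InnerProductSpace.toDual ℝ K (v k) ∈ Metric.closedBall (0 : StrongDual ℝ K) B
    rw [Metric.mem_closedBall, dist_zero_right, LinearIsometryEquiv.norm_map]
    exact hB k
  obtain ⟨g, -, φ, hφ, hg⟩ := WeakDual.isSeqCompact_closedBall ℝ K (0 : StrongDual ℝ K) B hf
  let w : K := (InnerProductSpace.toDual ℝ K).symm (WeakDual.toStrongDual g)
  refine ⟨w, φ, hφ, fun z => ?_⟩
  have h1 := (WeakDual.eval_continuous (𝕜 := ℝ) (K.orthogonalProjectionOnto z)).continuousAt.tendsto.comp hg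
  have h2 : ∀ a : K, ⟪(a : H), z⟫ = ⟪a, K.orthogonalProjectionOnto z⟫ := fun a =>
    (Submodule.inner_orthogonalProjectionOnto_eq_of_mem_left a z).symm
  have h3 : g (K.orthogonalProjectionOnto z) = ⟪(w : H), z⟫ := by
    rw [h2]
    exact (InnerProductSpace.toDual_symm_apply (𝕜 := ℝ) (y := WeakDual.toStrongDual g)).symm
  rw [← h3]
  refine h1.congr fun k => ?_
  exact (h2 (v (φ k))).symm

theorem sqInt_nonneg_aux {n : ℕ} (Ω T : Set (Fin n → ℝ))
    (x : Lp ℝ 2 (volume.restrict Ω)) : 0 ≤ sqInt Ω T x :=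
  integral_nonneg fun _ => sq_nonneg _

theorem norm_sq_aux {n : ℕ} (Ω : Set (Fin n → ℝ)) (hΩ : MeasurableSet Ω)
    (S : Set (Fin n → ℝ)) (hS : MeasurableSet S) (hSΩ : S ⊆ Ω)
    (x : Lp ℝ 2 (volume.restrict Ω)) :
    ‖x‖ ^ 2 = sqInt Ω S x + sqInt Ω (Ω \ S) x := by
  have hi : Integrable (fun t => (x t) ^ 2) (volume.restrict Ω) := (Lp.memLp x).integrable_sq
  have h1 : ‖x‖ ^ 2 = ∫ t, (x t) ^ 2 ∂(volume.restrict Ω) := by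
    rw [← real_inner_self_eq_norm_sq, L2.inner_def]
    refine integral_congr_ae (Eventually.of_forall fun t => ?_)
    simp [sq]
  unfold sqInt
  rw [h1, ← setIntegral_union Set.disjoint_sdiff_right (hΩ.diff hS) hi.integrableOn
    hi.integrableOn, Set.union_sdiff_cancel hSΩ, Measure.restrict_restrict hΩ, Set.inter_self]

/-- **Uniform boundedness of minimizers under varying data**: if `(y_k)`
converges in `Y` and `x_k` minimizes `J_{α,S,y_k}` over `D(F)`, then
`(‖x_k‖)` and `(‖F(x_k)‖)` are bounded; consequently there exist `x̄ ∈ D(F)`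
and a subsequence `(x_m)` of `(x_k)` with `x_m ⇀ x̄` weakly in `L²(Ω)` and
`F(x_m) ⇀ F(x̄)` weakly in `Y`. -/
theorem bounded_minimizers_and_weak_subsequence
    {n : ℕ} (Ω : Set (Fin n → ℝ)) (hΩmeas : MeasurableSet Ω)
    (hΩbdd : Bornology.IsBounded Ω)
    {Y : Type*} [NormedAddCommGroup Y] [InnerProductSpace ℝ Y] [CompleteSpace Y]
    (D : Set (Lp ℝ 2 (volume.restrict Ω))) (hD : D.Nonempty)
    (F : Lp ℝ 2 (volume.restrict Ω) → Y)
    (hFcont : ContinuousOn F D)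
    (hFweak : ∀ (u : ℕ → Lp ℝ 2 (volume.restrict Ω))
      (x : Lp ℝ 2 (volume.restrict Ω)) (z : Y),
      (∀ k, u k ∈ D) → WeakConv u x → WeakConv (fun k => F (u k)) z →
        x ∈ D ∧ F x = z)
    (xstar : Lp ℝ 2 (volume.restrict Ω))
    (α : ℝ) (hα : 0 < α)
    (S : Set (Fin n → ℝ)) (hSmeas : MeasurableSet S) (hSΩ : S ⊆ Ω)
    (ys : ℕ → Y) (hys : ∃ ylim : Y, Tendsto ys atTop (𝓝 ylim))
    (xs : ℕ → Lp ℝ 2 (volume.restrict Ω))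
    (hxs : ∀ k, IsMinimizer (J Ω F xstar α S (ys k)) D (xs k)) :
    (∃ B : ℝ, ∀ k, ‖xs k‖ ≤ B) ∧
    (∃ B : ℝ, ∀ k, ‖F (xs k)‖ ≤ B) ∧
    (∃ xbar ∈ D, ∃ φ : ℕ → ℕ, StrictMono φ ∧
      WeakConv (xs ∘ φ) xbar ∧
      WeakConv (fun m => F (xs (φ m))) (F xbar)) := by
  obtain ⟨ylim, hy⟩ := hys
  obtain ⟨x0, hx0⟩ := hD
  obtain ⟨C, hC⟩ := hy.norm.bddAbove_range
  have hC' : ∀ k, ‖ys k‖ ≤ C := fun k => hC (Set.mem_range_self k)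
  set R : ℝ := α * sqInt Ω S (x0 - xstar) + sqInt Ω (Ω \ S) (x0 - xstar) with hR
  set M : ℝ := (‖F x0‖ + C) ^ 2 + R with hM
  have hJ : ∀ k, ‖F (xs k) - ys k‖ ^ 2 + (α * sqInt Ω S (xs k - xstar)
      + sqInt Ω (Ω \ S) (xs k - xstar)) ≤ M := by
    intro k
    have h := (hxs k).2 x0 hx0
    unfold J at h
    have h1 : ‖F x0 - ys k‖ ≤ ‖F x0‖ + C := (norm_sub_le _ _).trans (by linarith [hC' k])
    have h2 : ‖F x0 - ys k‖ ^ 2 ≤ (‖F x0‖ + C) ^ 2 := by gcongr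
    linarith
  have hb1 : ∀ k, ‖xs k‖ ≤ √(M / α + M) + ‖xstar‖ := by
    intro k
    have hp := sqInt_nonneg_aux Ω S (xs k - xstar)
    have hq := sqInt_nonneg_aux Ω (Ω \ S) (xs k - xstar)
    have hap := mul_nonneg hα.le hp
    have hF := sq_nonneg ‖F (xs k) - ys k‖
    have h := hJ k
    have h1 : sqInt Ω S (xs k - xstar) ≤ M / α := by
      rw [le_div_iff₀ hα]; linarith
    have h2 : ‖xs k - xstar‖ ≤ √(M / α + M) := by
      apply Real.le_sqrt_of_sq_le
      rw [norm_sq_aux Ω hΩmeas S hSmeas hSΩ]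
      linarith
    have h3 := norm_add_le (xs k - xstar) xstar
    rw [sub_add_cancel] at h3
    linarith
  have hb2 : ∀ k, ‖F (xs k)‖ ≤ √M + C := by
    intro k
    have hp := sqInt_nonneg_aux Ω S (xs k - xstar)
    have hq := sqInt_nonneg_aux Ω (Ω \ S) (xs k - xstar)
    have hap := mul_nonneg hα.le hp
    have h := hJ k
    have h2 : ‖F (xs k) - ys k‖ ≤ √M := by
      apply Real.le_sqrt_of_sq_le
      linarith
    have h3 := norm_add_le (F (xs k) - ys k) (ys k)
    rw [sub_add_cancel] at h3
    linarith [hC' k]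
  refine ⟨⟨_, hb1⟩, ⟨_, hb2⟩, ?_⟩
  obtain ⟨x, φ, hφ, hx⟩ := weak_subseq_aux xs _ hb1
  obtain ⟨z, ψ, hψ, hz⟩ := weak_subseq_aux (fun k => F (xs (φ k))) _ (fun k => hb2 (φ k))
  have hx' : WeakConv (xs ∘ (φ ∘ ψ)) x := fun w => (hx w).comp hψ.tendsto_atTop
  have hz' : WeakConv (fun m => F (xs ((φ ∘ ψ) m))) z := hz
  obtain ⟨hxD, hFx⟩ := hFweak _ x z (fun k => (hxs _).1) hx' hz'
  exact ⟨x, hxD, φ ∘ ψ, hφ.comp hψ, hx', hFx ▸ hz'⟩
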